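/- For every natural number n, the following identity of polynomials in c and q holds: Σ over pairs (P, w), where P is a Motzkin path of length n and w assigns to each up step of P starting at height h a weight in {1, −q^{h+1}}, to each level step starting at height h the weight −q^h, and to each down step the weight c, such that P has no peak (an up step immediately followed by a down step) whose up step is assigned weight 1, of the product of the assigned weights of all steps, equals Σ_{j=0}^{⌊n/2⌋} c^j · (−1)^{n−j} · q^{j(j+1)/2} · [n−j choose j]_q, where [n−j choose j]_q is the Gaussian (q-)binomial coefficient. -/

import Mathlib

open Finset

inductive Step : Type
  | U | L | D
deriving DecidableEq

instance : Fintype Step where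
  elems := {Step.U, Step.L, Step.D}
  complete := by intro x; cases x <;> decide

/-- The vertical displacement of a step: up = +1, level = 0, down = -1. -/
def Step.val : Step → ℤ
  | .U => 1
  | .L => 0
  | .D => -1

/-- The partial sum of the step values of the first `i` steps;
this is the height at which step `i` starts. -/
def hsum {n : ℕ} (P : Fin n → Step) (i : ℕ) : ℤ :=
  ∑ j ∈ Finset.univ.filter (fun j : Fin n => (j : ℕ) < i), (P j).val

/-- A Motzkin path: all partial sums nonnegative and total sum 0. -/
abbrev IsMotzkin {n : ℕ} (P : Fin n → Step) : Prop :=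
  (∀ i : Fin (n+1), 0 ≤ hsum P (i : ℕ)) ∧ hsum P n = 0

/-- A Motzkin prefix of final height `k`: all partial sums nonnegative, total sum `k`. -/
abbrev IsMPrefix {n : ℕ} (P : Fin n → Step) (k : ℕ) : Prop :=
  (∀ i : Fin (n+1), 0 ≤ hsum P (i : ℕ)) ∧ hsum P n = (k : ℤ)

/-- `[h]_q = 1 + q + ... + q^(h-1)`. -/
def geo {R : Type*} [CommSemiring R] (q : R) (h : ℤ) : R :=
  ∑ i ∈ Finset.range h.toNat, q ^ i

/-- The Gaussian (q-)binomial coefficient, via the q-Pascal recurrence. -/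
def qbinom {R : Type*} [CommSemiring R] (q : R) : ℕ → ℕ → R
  | _, 0 => 1
  | 0, _+1 => 0
  | n+1, k+1 => qbinom q n k + q ^ (k+1) * qbinom q n (k+1)

/-- The binomial coefficient with integer lower argument, zero on negative arguments. -/
def ch (m : ℕ) (j : ℤ) : ℤ := if 0 ≤ j then m.choose j.toNat else 0

section QB
variable {R : Type*} [CommRing R] (q : R)

lemma qb_zero_right (n : ℕ) : qbinom q n 0 = 1 := by cases n <;> rfl

lemma qb_succ (n k : ℕ) :
    qbinom q (n+1) (k+1) = qbinom q n k + q ^ (k+1) * qbinom q n (k+1) := rfl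

lemma qb_lt : ∀ (n k : ℕ), n < k → qbinom q n k = 0
  | 0, 0, h => by omega
  | 0, k+1, _ => rfl
  | n+1, 0, h => by omega
  | n+1, k+1, h => by
    rw [qb_succ, qb_lt n k (by omega), qb_lt n (k+1) (by omega)]; ring

lemma qb_abs2 : ∀ (n k m : ℕ), m + k = n →
    (1 - q^(k+1)) * qbinom q n (k+1) = (1 - q^m) * qbinom q n k := by
  intro n
  induction n with
  | zero =>
    intro k m h
    obtain rfl : k = 0 := by omega
    obtain rfl : m = 0 := by omega
    simp [qbinom]
  | succ n ih =>
    intro k m h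
    rcases m with _ | m
    · rw [qb_lt q (n+1) (k+1) (by omega)]; simp
    · rcases k with _ | k
      · obtain rfl : m = n := by omega
        have := ih 0 m (by omega)
        rw [qb_succ]
        simp only [qb_zero_right] at *
        linear_combination q * this
      · have h1 := ih (k+1) m (by omega)
        have h2 := ih k (m+1) (by omega)
        obtain rfl : n = m + k + 1 := by omega
        rw [qb_succ q (m+k+1) (k+1), qb_succ q (m+k+1) k]
        linear_combination q^(k+2) * h1 + h2

lemma qb_abs1 (n k : ℕ) :
    (1 - q^(k+1)) * qbinom q (n+1) (k+1) = (1 - q^(n+1)) * qbinom q n k := by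
  rcases le_or_gt k n with h | h
  · obtain ⟨m, rfl⟩ := Nat.exists_eq_add_of_le' h
    have := qb_abs2 q (m+k) k m rfl
    rw [qb_succ]
    linear_combination q^(k+1) * this
  · rw [qb_lt q _ _ h, qb_lt q (n+1) (k+1) (by omega)]; simp

/-- coefficient -/
def aco (n h j : ℕ) : R :=
  (-1)^(n+h+j) * q^(j*(j+1)/2) * qbinom q (n-j) j * qbinom q (n-2*j) h

lemma aco_zero (n h j : ℕ) (H : n < h + 2*j) : aco q n h j = 0 := by
  unfold aco
  rcases lt_or_ge n (2*j) with h1 | h1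
  · rw [qb_lt q (n-j) j (by omega)]; ring
  · rw [qb_lt q (n-2*j) h (by omega)]; ring

lemma tri (j : ℕ) : (j+1)*(j+1+1)/2 = j*(j+1)/2 + (j+1) := by
  rw [show (j+1)*(j+1+1) = j*(j+1) + (j+1)*2 by ring, Nat.add_mul_div_right _ _ (by norm_num)]

lemma sg (a b : ℕ) (h : a % 2 = b % 2) : (-1 : R)^a = (-1)^b := by
  rw [neg_one_pow_eq_pow_mod_two, h, ← neg_one_pow_eq_pow_mod_two]

lemma aco_rec_ss (n h j : ℕ) :
    aco q (n+2) (h+1) (j+1) = (1 - q^(h+2)) * aco q (n+1) (h+2) j - aco q n (h+1) j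
      - q^(h+1) * aco q (n+1) (h+1) (j+1) + aco q (n+1) h (j+1) := by
  rcases lt_or_ge n (2*j) with H | H
  · rw [aco_zero q (n+2) _ _ (by omega), aco_zero q (n+1) _ _ (by omega),
      aco_zero q n _ _ (by omega), aco_zero q (n+1) _ _ (by omega),
      aco_zero q (n+1) _ _ (by omega)]; ring
  obtain ⟨m, rfl⟩ := Nat.exists_eq_add_of_le' H
  unfold aco
  rw [tri, sg (m+2*j+2+(h+1)+(j+1)) (m+h+j) (by omega),
    sg (m+2*j+1+(h+2)+j) (m+h+j+1) (by omega), sg (m+2*j+(h+1)+j) (m+h+j+1) (by omega),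
    sg (m+2*j+1+(h+1)+(j+1)) (m+h+j+1) (by omega), sg (m+2*j+1+h+(j+1)) (m+h+j) (by omega),
    show m+2*j+2-(j+1) = m+j+1 by omega, show m+2*j+2-2*(j+1) = m by omega,
    show m+2*j+1-j = m+j+1 by omega, show m+2*j+1-2*j=m+1 by omega,
    show m+2*j-j=m+j by omega, show m+2*j-2*j=m by omega,
    show m+2*j+1-(j+1)=m+j by omega, show m+2*j+1-2*(j+1)=m-1 by omega]
  have e1 := qb_abs1 q m (h+1)
  have e2 := qb_abs2 q (m+j+1) j (m+1) (by omega)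
  have e3 := qb_succ q (m+j) j
  have e4 : q^(j+1) * qbinom q (m+j) (j+1) * qbinom q m (h+1) =
     q^(j+1) * qbinom q (m+j) (j+1) * (qbinom q (m-1) h + q^(h+1) * qbinom q (m-1) (h+1)) := by
    rcases m with _ | m
    · rw [qb_lt q (0+j) (j+1) (by omega)]; ring
    · rfl
  linear_combination (-1)^(m+h+j) * q^(j*(j+1)/2) * (qbinom q (m+j+1) j * e1
    - qbinom q m (h+1) * e2 + qbinom q m (h+1) * e3 + e4)

lemma aco_rec_0s (n j : ℕ) :
    aco q (n+2) 0 (j+1) = (1 - q) * aco q (n+1) 1 j - aco q n 0 j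
      - aco q (n+1) 0 (j+1) := by
  rcases lt_or_ge n (2*j) with H | H
  · rw [aco_zero q (n+2) _ _ (by omega), aco_zero q (n+1) _ _ (by omega),
      aco_zero q n _ _ (by omega), aco_zero q (n+1) _ _ (by omega)]; ring
  obtain ⟨m, rfl⟩ := Nat.exists_eq_add_of_le' H
  unfold aco
  rw [tri, sg (m+2*j+2+0+(j+1)) (m+j+1) (by omega),
    sg (m+2*j+1+1+j) (m+j) (by omega), sg (m+2*j+0+j) (m+j) (by omega),
    sg (m+2*j+1+0+(j+1)) (m+j) (by omega),
    show m+2*j+2-(j+1) = m+j+1 by omega,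
    show m+2*j+1-j = m+j+1 by omega, show m+2*j+1-2*j=m+1 by omega,
    show m+2*j-j=m+j by omega,
    show m+2*j+1-(j+1)=m+j by omega]
  simp only [qb_zero_right]
  have e1 := qb_abs1 q m 0
  have e2 := qb_abs2 q (m+j+1) j (m+1) (by omega)
  have e3 := qb_succ q (m+j) j
  simp only [qb_zero_right] at e1
  linear_combination -(-1)^(m+j) * q^(j*(j+1)/2) * (qbinom q (m+j+1) j * e1
    - e2 + e3)

lemma aco_rec_s0 (n h : ℕ) :
    aco q (n+2) (h+1) 0 = - q^(h+1) * aco q (n+1) (h+1) 0 + aco q (n+1) h 0 := by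
  unfold aco
  simp only [qb_zero_right, Nat.sub_zero, mul_zero, qb_succ q (n+1) h]
  ring

lemma aco_rec_00 (n : ℕ) : aco q (n+2) 0 0 = - aco q (n+1) 0 0 := by
  unfold aco
  simp only [qb_zero_right]
  ring

variable (c : R)

def FF (n h : ℕ) : R := ∑ j ∈ range (n+1), c^(h+j) * aco q n h j

lemma FF_eq (n h N : ℕ) (H : n ≤ 2*N) (H' : 0 < N ∨ 0 < h ∨ 0 < n) (H'' : n < h + 2*N) :
    FF q c n h = ∑ j ∈ range N, c^(h+j) * aco q n h j := by
  unfold FF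
  rcases le_or_gt N (n+1) with h1 | h1
  · symm
    apply Finset.sum_subset (by simpa using h1)
    intro j _ hj
    simp only [mem_range, not_lt] at hj
    rw [aco_zero q n h j (by omega), mul_zero]
  · apply Finset.sum_subset (by simpa using h1.le)
    intro j _ hj
    simp only [mem_range, not_lt] at hj
    rw [aco_zero q n h j (by omega), mul_zero]

lemma FF_rec_s (n h : ℕ) : FF q c (n+2) (h+1) = (1 - q^(h+2)) * FF q c (n+1) (h+2)
    - c * FF q c n (h+1) - q^(h+1) * FF q c (n+1) (h+1) + c * FF q c (n+1) h := by
  rw [FF_eq q c (n+2) (h+1) (n+2+1) (by omega) (by omega) (by omega),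
    FF_eq q c (n+1) (h+2) (n+2) (by omega) (by omega) (by omega),
    FF_eq q c n (h+1) (n+2) (by omega) (by omega) (by omega),
    FF_eq q c (n+1) (h+1) (n+2+1) (by omega) (by omega) (by omega),
    FF_eq q c (n+1) h (n+2+1) (by omega) (by omega) (by omega)]
  rw [sum_range_succ' _ (n+2), sum_range_succ' _ (n+2), sum_range_succ' _ (n+2)]
  simp only [mul_add, mul_sum]
  rw [aco_rec_s0]
  have : ∑ k ∈ range (n+2), c^(h+1+(k+1)) * aco q (n+2) (h+1) (k+1) =
    ∑ k ∈ range (n+2), ((1 - q^(h+2)) * (c^(h+2+k) * aco q (n+1) (h+2) k)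
      - c * (c^(h+1+k) * aco q n (h+1) k)
      - q^(h+1) * (c^(h+1+(k+1)) * aco q (n+1) (h+1) (k+1))
      + c * (c^(h+(k+1)) * aco q (n+1) h (k+1))) := by
    apply sum_congr rfl
    intro k _
    rw [aco_rec_ss]; ring
  rw [this]
  simp only [sum_add_distrib, sum_sub_distrib]
  ring

lemma FF_rec_0 (n : ℕ) : FF q c (n+2) 0 = (1 - q) * FF q c (n+1) 1
    - c * FF q c n 0 - FF q c (n+1) 0 := by
  rw [FF_eq q c (n+2) 0 (n+2+1) (by omega) (by omega) (by omega),
    FF_eq q c (n+1) 1 (n+2) (by omega) (by omega) (by omega),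
    FF_eq q c n 0 (n+2) (by omega) (by omega) (by omega),
    FF_eq q c (n+1) 0 (n+2+1) (by omega) (by omega) (by omega)]
  rw [sum_range_succ' _ (n+2), sum_range_succ' _ (n+2)]
  simp only [mul_sum]
  rw [aco_rec_00]
  have : ∑ k ∈ range (n+2), c^(0+(k+1)) * aco q (n+2) 0 (k+1) =
    ∑ k ∈ range (n+2), ((1 - q) * (c^(1+k) * aco q (n+1) 1 k)
      - c * (c^(0+k) * aco q n 0 k)
      - (c^(0+(k+1)) * aco q (n+1) 0 (k+1))) := by
    apply sum_congr rfl
    intro k _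
    rw [aco_rec_0s]; ring
  rw [this]
  simp only [sum_sub_distrib]
  ring

def TT : ℕ → ℕ → Bool → R
  | 0, 0, _ => 1
  | 0, _+1, _ => 0
  | n+1, 0, _ => TT n 1 true - q * TT n 1 false - TT n 0 false
  | n+1, h+1, b => TT n (h+2) true - q^(h+2) * TT n (h+2) false - q^(h+1) * TT n (h+1) false
      + if b then 0 else c * TT n h false

lemma TT_true_succ (n h : ℕ) : TT q c (n+1) (h+1) true
    = TT q c (n+1) (h+1) false - c * TT q c n h false := by
  simp [TT]

lemma TT_eq (n : ℕ) : (∀ h, TT q c n h false = FF q c n h) ∧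
    (∀ h, TT q c (n+1) h false = FF q c (n+1) h) := by
  induction n with
  | zero =>
    constructor
    · intro h
      rcases h with _ | h <;> simp [TT, FF, aco, qbinom]
    · intro h
      rcases h with _ | _ | h <;>
        simp [TT, FF, aco, qbinom, sum_range_succ]
  | succ n ih =>
    refine ⟨ih.2, ?_⟩
    intro h
    rcases h with _ | h
    · rw [FF_rec_0, TT, TT_true_succ, ih.1, ih.2, ih.2]; ring
    · rw [FF_rec_s, TT, TT_true_succ, ih.1, ih.2, ih.2, ih.2]; simp; ring

def GG : (n : ℕ) → ℕ → Bool → (Fin n → Step) → (Fin n → Bool) → R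
  | 0, h, _, _, _ => if h = 0 then 1 else 0
  | n+1, h, b, P, w =>
    match P 0, w 0 with
    | .U, true => GG n (h+1) true (Fin.tail P) (Fin.tail w)
    | .U, false => -q^(h+1) * GG n (h+1) false (Fin.tail P) (Fin.tail w)
    | .L, true => -q^h * GG n h false (Fin.tail P) (Fin.tail w)
    | .D, true => if b = true ∨ h = 0 then 0 else
        c * GG n (h-1) false (Fin.tail P) (Fin.tail w)
    | _, _ => 0

lemma sum_consq {M : Type*} [AddCommMonoid M] (n : ℕ) (α : Type*) [Fintype α]
    (f : (Fin (n+1) → α) → M) : ∑ P, f P = ∑ a, ∑ P : Fin n → α, f (Fin.cons a P) := by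
  rw [← (Fin.consEquiv (fun _ : Fin (n+1) => α)).sum_comp, Fintype.sum_prod_type]
  rfl

lemma sum_step {M : Type*} [AddCommMonoid M] (f : Step → M) :
    ∑ a, f a = f .U + (f .L + f .D) := by
  have : (univ : Finset Step) = {Step.U, Step.L, Step.D} := rfl
  rw [this, sum_insert (by decide), sum_insert (by decide), sum_singleton]

lemma GG_sum : ∀ (n h : ℕ) (b : Bool),
    ∑ P : Fin n → Step, ∑ w : Fin n → Bool, GG q c n h b P w = TT q c n h b := by
  intro n
  induction n with
  | zero => intro h b; rcases h with _ | h <;> simp [GG, TT]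
  | succ n ih =>
    intro h b
    rw [sum_consq, sum_step]
    simp only [sum_consq, Fintype.sum_bool, GG, Fin.cons_zero, Fin.tail_cons]
    simp only [sum_add_distrib, ← mul_sum, ih, sum_const_zero]
    rcases h with _ | h
    · simp [TT]; ring
    · cases b
      · simp [TT, ← mul_sum, ih]; ring
      · simp [TT]; ring

def Cond {n : ℕ} (h : ℕ) (b : Bool) (P : Fin n → Step) (w : Fin n → Bool) : Prop :=
  (∀ i : ℕ, i ≤ n → 0 ≤ (h : ℤ) + hsum P i) ∧ (h : ℤ) + hsum P n = 0 ∧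
  (∀ i, P i ≠ Step.U → w i = true) ∧
  (∀ i j : Fin n, (j : ℕ) = (i : ℕ) + 1 →
            ¬(P i = Step.U ∧ P j = Step.D ∧ w i = true)) ∧
  (b = true → ∀ i : Fin n, (i : ℕ) = 0 → P i ≠ Step.D)

def wt {n : ℕ} (h : ℕ) (P : Fin n → Step) (w : Fin n → Bool) (i : Fin n) : R :=
  match P i with
            | Step.U =>
                if w i then 1
                else -q ^ (((h : ℤ) + hsum P (i : ℕ)).toNat + 1)
            | Step.L => -q ^ ((h : ℤ) + hsum P (i : ℕ)).toNat
            | Step.D => c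

lemma hsum_zero {n : ℕ} (P : Fin n → Step) : hsum P 0 = 0 := by simp [hsum]

lemma hsum_cons {n : ℕ} (s : Step) (P : Fin n → Step) (i : ℕ) :
    hsum (Fin.cons s P : Fin (n+1) → Step) (i+1) = s.val + hsum P i := by
  unfold hsum
  rw [sum_filter, sum_filter, Fin.sum_univ_succ]
  simp

lemma Cond_cons {n : ℕ} (h : ℕ) (b : Bool) (s : Step) (x : Bool) (P : Fin n → Step)
    (w : Fin n → Bool) (h' : ℕ) (hh : (h : ℤ) + s.val = h') :
    Cond h b (Fin.cons s P : Fin (n+1) → Step) (Fin.cons x w : Fin (n+1) → Bool) ↔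
    (s ≠ .U → x = true) ∧ (b = true → s ≠ .D) ∧ Cond h' (decide (s = .U) && x) P w := by
  unfold Cond
  have A : (∀ i : ℕ, i ≤ n+1 → 0 ≤ (h : ℤ) + hsum (Fin.cons s P : Fin (n+1) → Step) i) ↔
      (∀ i : ℕ, i ≤ n → 0 ≤ (h' : ℤ) + hsum P i) := by
    constructor
    · intro H i hi
      have := H (i+1) (by omega)
      rw [hsum_cons] at this
      omega
    · intro H i hi
      rcases i with _ | i
      · rw [hsum_zero]; omega
      · have := H i (by omega)
        rw [hsum_cons]; omega
  have B : (h : ℤ) + hsum (Fin.cons s P : Fin (n+1) → Step) (n+1) = 0 ↔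
      (h' : ℤ) + hsum P n = 0 := by
    rw [hsum_cons]; omega
  rw [A, B]
  have C : (∀ i j : Fin (n+1), (j : ℕ) = (i : ℕ) + 1 →
            ¬((Fin.cons s P : Fin (n+1) → Step) i = Step.U ∧
              (Fin.cons s P : Fin (n+1) → Step) j = Step.D ∧
              (Fin.cons x w : Fin (n+1) → Bool) i = true)) ↔
      (∀ i j : Fin n, (j : ℕ) = (i : ℕ) + 1 → ¬(P i = Step.U ∧ P j = Step.D ∧ w i = true)) ∧
      ((decide (s = .U) && x) = true → ∀ i : Fin n, (i : ℕ) = 0 → P i ≠ Step.D) := by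
    rw [Fin.forall_fin_succ]
    simp only [Fin.forall_fin_succ, Fin.cons_zero, Fin.cons_succ, Fin.val_zero, Fin.val_succ]
    constructor
    · rintro ⟨⟨_, H1⟩, H2⟩
      refine ⟨fun i j hij => (H2 i).2 j (by omega), ?_⟩
      intro hb i hi hD
      simp only [Bool.and_eq_true, decide_eq_true_eq] at hb
      exact H1 i (by omega) ⟨hb.1, hD, hb.2⟩
    · rintro ⟨H1, H2⟩
      refine ⟨⟨by simp, ?_⟩, ?_⟩
      · rintro i hi ⟨h1, h2, h3⟩
        exact H2 (by simp [h1, h3]) i (by omega) h2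
      · intro i
        exact ⟨by simp, fun j hij => H1 i j (by omega)⟩
  rw [C]
  simp only [Fin.forall_fin_succ, Fin.cons_zero, Fin.cons_succ, Fin.val_zero, Fin.val_succ]
  simp only [Nat.succ_ne_zero, Nat.add_eq_zero_iff, false_imp_iff, implies_true, and_true,
    true_imp_iff, one_ne_zero, and_false]
  tauto

lemma wt_cons_succ {n : ℕ} (h : ℕ) (s : Step) (x : Bool) (P : Fin n → Step)
    (w : Fin n → Bool) (h' : ℕ) (hh : (h : ℤ) + s.val = h') (i : Fin n) :
    wt q c h (Fin.cons s P : Fin (n+1) → Step) (Fin.cons x w : Fin (n+1) → Bool) i.succ =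
    wt q c h' P w i := by
  unfold wt
  simp only [Fin.cons_succ, Fin.val_succ, hsum_cons, ← add_assoc, hh]

open Classical in
lemma GG_eq : ∀ (n h : ℕ) (b : Bool) (P : Fin n → Step) (w : Fin n → Bool),
    GG q c n h b P w = if Cond h b P w then ∏ i, wt q c h P w i else 0 := by
  intro n
  induction n with
  | zero =>
    intro h b P w
    simp only [GG, Cond, univ_eq_empty, prod_empty]
    congr 1
    simp [hsum]
  | succ n ih =>
    intro h b P w
    obtain ⟨s, P, rfl⟩ : ∃ s P', P = Fin.cons s P' := ⟨P 0, Fin.tail P, (Fin.cons_self_tail P).symm⟩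
    obtain ⟨x, w, rfl⟩ : ∃ s P', w = Fin.cons s P' := ⟨w 0, Fin.tail w, (Fin.cons_self_tail w).symm⟩
    simp only [GG, Fin.cons_zero, Fin.tail_cons, ih]
    rw [Fin.prod_univ_succ]
    cases s
    · simp only [Cond_cons h b .U x P w (h+1) (by simp [Step.val]),
        wt_cons_succ q c h .U x P w (h+1) (by simp [Step.val])]
      cases x <;> simp [wt, hsum_zero]
    · simp only [Cond_cons h b .L x P w h (by simp [Step.val]),
        wt_cons_succ q c h .L x P w h (by simp [Step.val])]
      cases x <;> simp [wt, hsum_zero]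
    · rcases h with _ | h
      · have : ¬ Cond 0 b (Fin.cons .D P : Fin (n+1) → Step) (Fin.cons x w : Fin (n+1) → Bool) := by
          intro H
          have := H.1 (0+1) (by omega)
          rw [hsum_cons, hsum_zero] at this
          simp [Step.val] at this
        rw [if_neg this]
        cases x <;> simp
      · simp only [Cond_cons (h+1) b .D x P w h (by simp [Step.val]),
          wt_cons_succ q c (h+1) .D x P w h (by simp [Step.val])]
        cases x <;> cases b <;> simp [wt]

end QB

open MvPolynomial in
/-- The total weight of labelled Motzkin paths of length `n` (up steps labelled
`1` or `-q^(h+1)`, level steps weighted `-q^h`, down steps weighted `c`, no peak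
whose up step is labelled `1`) is `∑_j c^j (-1)^(n-j) q^(j(j+1)/2) [n-j choose j]_q`.
Here `c = X 0`, `q = X 1`, and the label `w` is canonically `true` off up steps. -/
theorem stmt14 (n : ℕ) :
    (∑ pw ∈ Finset.univ.filter
        (fun pw : (Fin n → Step) × (Fin n → Bool) =>
          IsMotzkin pw.1 ∧
          (∀ i, pw.1 i ≠ Step.U → pw.2 i = true) ∧
          ∀ i j : Fin n, (j : ℕ) = (i : ℕ) + 1 →
            ¬(pw.1 i = Step.U ∧ pw.1 j = Step.D ∧ pw.2 i = true)),
      ∏ i, (match pw.1 i with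
            | Step.U =>
                if pw.2 i then 1
                else -(X 1 : MvPolynomial (Fin 2) ℤ) ^ ((hsum pw.1 (i : ℕ)).toNat + 1)
            | Step.L => -(X 1 : MvPolynomial (Fin 2) ℤ) ^ (hsum pw.1 (i : ℕ)).toNat
            | Step.D => (X 0 : MvPolynomial (Fin 2) ℤ)))
    = ∑ j ∈ Finset.range (n/2 + 1),
        (X 0 : MvPolynomial (Fin 2) ℤ) ^ j * (-1) ^ (n - j) *
        (X 1) ^ (j * (j+1) / 2) * qbinom (X 1 : MvPolynomial (Fin 2) ℤ) (n - j) j := by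
  classical
  have key := (TT_eq (X 1 : MvPolynomial (Fin 2) ℤ) (X 0) n).1 0
  rw [← GG_sum] at key
  simp only [GG_eq] at key
  rw [FF_eq _ _ n 0 (n/2+1) (by omega) (by omega) (by omega)] at key
  rw [sum_filter, Fintype.sum_prod_type]
  refine Eq.trans ?_ (key.trans ?_)
  · apply sum_congr rfl
    intro P _
    apply sum_congr rfl
    intro w _
    have hc : (IsMotzkin P ∧ (∀ i, P i ≠ Step.U → w i = true) ∧
          ∀ i j : Fin n, (j : ℕ) = (i : ℕ) + 1 →
            ¬(P i = Step.U ∧ P j = Step.D ∧ w i = true)) ↔ Cond 0 false P w := by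
      unfold Cond IsMotzkin
      constructor
      · rintro ⟨⟨h1, h2⟩, h3, h4⟩
        refine ⟨fun i hi => ?_, by simpa using h2, h3, h4, by simp⟩
        simpa using h1 ⟨i, by omega⟩
      · rintro ⟨h1, h2, h3, h4, _⟩
        refine ⟨⟨fun i => ?_, by simpa using h2⟩, h3, h4⟩
        simpa using h1 i (by omega)
    refine if_congr hc ?_ rfl
    apply prod_congr rfl
    intro i _
    simp only [wt, Nat.cast_zero, zero_add]
  · apply sum_congr rfl
    intro j hj
    simp only [mem_range] at hj
    unfold aco
    rw [qb_zero_right, sg (n+0+j) (n-j) (by omega), zero_add]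
    ring
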